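/- Let 𝒜 be a Banach algebra over ℍ with scalar embedding φ, and let A ∈ 𝒜 commute with φ(z) for every z ∈ ℍ. Then the sequence ‖Aⁿ‖^{1/n} converges and the spectral radius of A satisfies r(A) = lim_{n→∞} ‖Aⁿ‖^{1/n}. -/

import Mathlib

local notation "ℍ" => Quaternion ℝ

/-- The ℍ-spectrum of an element `x` of a Banach algebra over ℍ with scalar
embedding `φ`. -/
def qSpectrum {A : Type*} [NormedRing A] [NormedAlgebra ℝ A]
    (φ : ℍ →ₐ[ℝ] A) (x : A) : Set ℍ :=
  {z : ℍ | ¬ IsUnit (φ z - x)}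

/-- The spectral radius `r(x) = sup{‖z‖ : z ∈ σ(x)}` of an element of a Banach
algebra over ℍ. -/
noncomputable def qSpectralRadius {A : Type*} [NormedRing A] [NormedAlgebra ℝ A]
    (φ : ℍ →ₐ[ℝ] A) (x : A) : ℝ :=
  sSup {r : ℝ | ∃ z ∈ qSpectrum φ x, r = ‖z‖}

open Filter Topology

theorem norm_coeComplex_quaternion (z : ℂ) : ‖(z : ℍ)‖ = ‖z‖ := by
  rw [← sq_eq_sq₀ (norm_nonneg _) (norm_nonneg _), Complex.sq_norm, sq,
    ← Quaternion.normSq_eq_norm_mul_self, Quaternion.normSq_def', Complex.normSq_apply]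
  simp [sq]

/-- The norm of a spectral value is bounded by every `‖aⁿ‖^(1/n)` with `n ≠ 0`. -/
theorem norm_le_of_mem_qSpectrum {A : Type*} [NormedRing A] [NormedAlgebra ℝ A] [CompleteSpace A]
    [NormOneClass A] (φ : ℍ →ₐ[ℝ] A) (hφ : ∀ z : ℍ, ‖φ z‖ = ‖z‖)
    (a : A) (ha : ∀ z : ℍ, a * φ z = φ z * a) {z : ℍ} (hz : z ∈ qSpectrum φ a)
    {n : ℕ} (hn : n ≠ 0) : ‖z‖ ≤ ‖a ^ n‖ ^ ((n : ℝ)⁻¹) := by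
  have hpow : ‖z‖ ^ n ≤ ‖a ^ n‖ := by
    by_contra! hlt
    refine hz ?_
    have hz0 : z ^ n ≠ 0 := by
      rw [← norm_ne_zero_iff, norm_pow]
      exact ((norm_nonneg _).trans_lt hlt).ne'
    have hmul : φ (z ^ n) * φ (z ^ n)⁻¹ = 1 := by
      rw [← map_mul, mul_inv_cancel₀ hz0, map_one]
    have hsmall : ‖φ (z ^ n)⁻¹ * a ^ n‖ < 1 := by
      refine (norm_mul_le _ _).trans_lt ?_
      rw [hφ, norm_inv, norm_pow, inv_mul_lt_one₀ ((norm_nonneg _).trans_lt hlt)]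
      exact hlt
    have hunit : IsUnit (φ z ^ n - a ^ n) := by
      have h := ((isUnit_iff_ne_zero.mpr hz0).map φ).mul (isUnit_one_sub_of_norm_lt_one hsmall)
      rwa [mul_sub, mul_one, ← mul_assoc, hmul, one_mul, map_pow] at h
    have hcomm : Commute (φ z) a := (ha z).symm
    rw [← hcomm.mul_geom_sum₂] at hunit
    refine ((Commute.isUnit_mul_iff ?_).mp hunit).1
    have h₁ : Commute (φ z - a) (φ z) := (Commute.refl _).sub_left hcomm.symm
    have h₂ : Commute (φ z - a) a := hcomm.sub_left (Commute.refl _)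
    exact Commute.sum_right _ _ _ fun i _ => (h₁.pow_right i).mul_right (h₂.pow_right _)
  calc ‖z‖ = (‖z‖ ^ n) ^ ((n : ℝ)⁻¹) := (Real.pow_rpow_inv_natCast (norm_nonneg _) hn).symm
    _ ≤ _ := Real.rpow_le_rpow (by positivity) hpow (by positivity)

/-- Gelfand's formula for an isometric, not necessarily central, embedding of `ℂ`: an element
commuting with the complex scalars has a complex spectral value of norm `lim ‖aⁿ‖^(1/n)`. -/
theorem exists_not_isUnit_tendsto_norm {A : Type*} [NormedRing A] [NormedAlgebra ℝ A]
    [CompleteSpace A] [NormOneClass A] (g : ℂ →ₐ[ℝ] A) (hg : ∀ z, ‖g z‖ = ‖z‖)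
    (a : A) (ha : ∀ z, g z * a = a * g z) :
    ∃ z : ℂ, ¬ IsUnit (g z - a) ∧
      Tendsto (fun n : ℕ => ‖a ^ n‖ ^ ((n : ℝ)⁻¹)) atTop (𝓝 ‖z‖) := by
  let B : Subalgebra ℝ A := Subalgebra.centralizer ℝ (Set.range g)
  have hmem {x : A} : x ∈ B ↔ ∀ z, g z * x = x * g z := by
    simp [B, Subalgebra.mem_centralizer_iff]
  have hgB (z : ℂ) : g z ∈ B := hmem.mpr fun w => by rw [← map_mul, mul_comm, map_mul]
  have hclosed : IsClosed (B : Set A) := Set.isClosed_centralizer (Set.range g)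
  have : CompleteSpace B := hclosed.completeSpace_coe
  let : Algebra ℂ B := (g.codRestrict B hgB).toRingHom.toAlgebra' fun z x =>
    Subtype.ext (hmem.mp x.2 z)
  let : NormedAlgebra ℂ B :=
    { norm_smul_le := fun z x => by
        rw [Algebra.smul_def]
        refine (norm_mul_le _ _).trans_eq ?_
        congr 1
        exact hg z }
  have : Nontrivial A := NormOneClass.nontrivial
  let b : B := ⟨a, hmem.mpr ha⟩
  obtain ⟨z, hz, hzr⟩ := spectrum.exists_nnnorm_eq_spectralRadius b
  refine ⟨z, fun hu => hz ?_, ?_⟩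
  · obtain ⟨u, hu⟩ := hu
    have huB : (u : A) ∈ B := hu ▸ B.sub_mem (hgB z) b.2
    have hinv : ((u⁻¹ : Aˣ) : A) ∈ B := hmem.mpr fun w =>
      (show Commute (g w) (u : A) from hmem.mp huB w).units_inv_right
    have hres : algebraMap ℂ B z - b = ⟨u, huB⟩ := Subtype.ext hu.symm
    rw [resolventSet, Set.mem_ofPred_eq, hres]
    exact ⟨⟨⟨u, huB⟩, ⟨_, hinv⟩, Subtype.ext u.mul_inv, Subtype.ext u.inv_mul⟩, rfl⟩
  · have h := spectrum.pow_norm_pow_one_div_tendsto_nhds_spectralRadius b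
    rw [← hzr] at h
    have h' := (ENNReal.tendsto_toReal ENNReal.coe_ne_top).comp h
    refine h'.congr fun n => ?_
    rw [Function.comp_apply, ENNReal.toReal_ofReal (by positivity), one_div]
    rfl

/-- Gelfand's formula over ℍ: for an element `a` of a Banach algebra over ℍ
commuting with all quaternion scalars, `‖aⁿ‖^(1/n)` converges to the spectral
radius `r(a)`. -/
theorem stmt_9 {A : Type*} [NormedRing A] [NormedAlgebra ℝ A] [CompleteSpace A]
    [NormOneClass A]
    (φ : ℍ →ₐ[ℝ] A) (hφ : ∀ z : ℍ, ‖φ z‖ = ‖z‖)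
    (a : A) (ha : ∀ z : ℍ, a * φ z = φ z * a) :
    Filter.Tendsto (fun n : ℕ => ‖a ^ n‖ ^ ((n : ℝ)⁻¹)) Filter.atTop
      (nhds (qSpectralRadius φ a)) := by
  obtain ⟨w, hw, hlim⟩ := exists_not_isUnit_tendsto_norm (φ.comp Quaternion.ofComplex)
    (fun z => (hφ _).trans (norm_coeComplex_quaternion z)) a (fun z => (ha _).symm)
  have hgreatest : IsGreatest {r : ℝ | ∃ z ∈ qSpectrum φ a, r = ‖z‖} ‖w‖ := by
    refine ⟨⟨(w : ℍ), hw, (norm_coeComplex_quaternion w).symm⟩, ?_⟩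
    rintro _ ⟨z, hz, rfl⟩
    refine ge_of_tendsto hlim ?_
    filter_upwards [eventually_ne_atTop 0] with n hn
    exact norm_le_of_mem_qSpectrum φ hφ a ha hz hn
  rwa [qSpectralRadius, hgreatest.csSup_eq]
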